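/- The derivability problem for !wL1 is undecidable: the predicate 'the sequent Π → A is derivable in !wL1', on the (countable, effectively encodable) set of !wL1-sequents, is not a computable (decidable) predicate. -/

import Mathlib

namespace Lambek

/-! ## Formulae of `!bL1` (Lambek calculus with unit, brackets and subexponential) -/

/-- Formulae: primitive types, the unit `1`, `\`, `/`, `·`, `⟨⟩`, `[]⁻¹`, `!`. -/
inductive Fm : Type
  | var : ℕ → Fm
  | one : Fm
  | ldiv : Fm → Fm → Fm   -- `ldiv A C` is `A \ C`
  | rdiv : Fm → Fm → Fm   -- `rdiv C B` is `C / B`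
  | mul : Fm → Fm → Fm    -- `A · B`
  | dia : Fm → Fm         -- `⟨⟩ A`
  | binv : Fm → Fm        -- `[]⁻¹ A`
  | bang : Fm → Fm        -- `! A`

/-- Items of a meta-formula: a formula or a bracketed meta-formula. -/
inductive Item : Type
  | fm : Fm → Item
  | br : List Item → Item

/-- Meta-formulae (configurations): finite ordered sequences of items. -/
abbrev Meta := List Item

/-- `!A₁, …, !Aₙ` as a meta-formula. -/
def bangs (Φ : List Fm) : Meta := Φ.map (fun F => Item.fm (Fm.bang F))

/-- A meta-formula with a designated (hole) occurrence of a meta-formula,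
possibly under nested brackets. -/
inductive Ctx : Type
  | hole : Meta → Meta → Ctx
  | br : Meta → Ctx → Meta → Ctx

/-- Plug a meta-formula into the designated occurrence. -/
def Ctx.fill : Ctx → Meta → Meta
  | Ctx.hole Δ₁ Δ₂, Γ => Δ₁ ++ Γ ++ Δ₂
  | Ctx.br Δ₁ c Δ₂, Γ => Δ₁ ++ (Item.br (c.fill Γ)) :: Δ₂

/-- Derivability in `!bL1`.  The boolean parameter says whether the rule (cut)
is allowed: `DervB true` is full `!bL1`, `DervB false` is cut-free derivability. -/
inductive DervB : Bool → Meta → Fm → Prop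
  | id (cf : Bool) (A : Fm) : DervB cf [Item.fm A] A
  | one_r (cf : Bool) : DervB cf [] Fm.one
  | rdiv_l (cf : Bool) (Δ : Ctx) (Γ : Meta) (B C D : Fm) :
      DervB cf Γ B → DervB cf (Δ.fill [Item.fm C]) D →
      DervB cf (Δ.fill (Item.fm (Fm.rdiv C B) :: Γ)) D
  | rdiv_r (cf : Bool) (Γ : Meta) (B C : Fm) :
      DervB cf (Γ ++ [Item.fm B]) C → DervB cf Γ (Fm.rdiv C B)
  | ldiv_l (cf : Bool) (Δ : Ctx) (Γ : Meta) (A C D : Fm) :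
      DervB cf Γ A → DervB cf (Δ.fill [Item.fm C]) D →
      DervB cf (Δ.fill (Γ ++ [Item.fm (Fm.ldiv A C)])) D
  | ldiv_r (cf : Bool) (Γ : Meta) (A C : Fm) :
      DervB cf (Item.fm A :: Γ) C → DervB cf Γ (Fm.ldiv A C)
  | mul_l (cf : Bool) (Δ : Ctx) (A B D : Fm) :
      DervB cf (Δ.fill [Item.fm A, Item.fm B]) D →
      DervB cf (Δ.fill [Item.fm (Fm.mul A B)]) D
  | mul_r (cf : Bool) (Γ₁ Γ₂ : Meta) (A B : Fm) :
      DervB cf Γ₁ A → DervB cf Γ₂ B → DervB cf (Γ₁ ++ Γ₂) (Fm.mul A B)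
  | one_l (cf : Bool) (Δ : Ctx) (A : Fm) :
      DervB cf (Δ.fill []) A → DervB cf (Δ.fill [Item.fm Fm.one]) A
  | dia_l (cf : Bool) (Δ : Ctx) (A C : Fm) :
      DervB cf (Δ.fill [Item.br [Item.fm A]]) C →
      DervB cf (Δ.fill [Item.fm (Fm.dia A)]) C
  | dia_r (cf : Bool) (Θ : Meta) (A : Fm) :
      DervB cf Θ A → DervB cf [Item.br Θ] (Fm.dia A)
  | binv_l (cf : Bool) (Δ : Ctx) (A C : Fm) :
      DervB cf (Δ.fill [Item.fm A]) C →
      DervB cf (Δ.fill [Item.br [Item.fm (Fm.binv A)]]) C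
  | binv_r (cf : Bool) (Θ : Meta) (A : Fm) :
      DervB cf [Item.br Θ] A → DervB cf Θ (Fm.binv A)
  | bang_l (cf : Bool) (Δ : Ctx) (A B : Fm) :
      DervB cf (Δ.fill [Item.fm A]) B → DervB cf (Δ.fill [Item.fm (Fm.bang A)]) B
  | bang_r (cf : Bool) (Φ : List Fm) (A : Fm) :
      DervB cf (bangs Φ) A → DervB cf (bangs Φ) (Fm.bang A)
  | contr (cf : Bool) (Δ : Ctx) (Φ : List Fm) (Γ : Meta) (B : Fm) :
      Φ ≠ [] →
      DervB cf (Δ.fill (bangs Φ ++ [Item.br (bangs Φ ++ Γ)])) B →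
      DervB cf (Δ.fill (bangs Φ ++ Γ)) B
  | perm1 (cf : Bool) (Δ : Ctx) (A : Fm) (Γ : Meta) (B : Fm) :
      DervB cf (Δ.fill (Item.fm (Fm.bang A) :: Γ)) B →
      DervB cf (Δ.fill (Γ ++ [Item.fm (Fm.bang A)])) B
  | perm2 (cf : Bool) (Δ : Ctx) (A : Fm) (Γ : Meta) (B : Fm) :
      DervB cf (Δ.fill (Γ ++ [Item.fm (Fm.bang A)])) B →
      DervB cf (Δ.fill (Item.fm (Fm.bang A) :: Γ)) B
  | cut (Δ : Ctx) (Θ : Meta) (A C : Fm) :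
      DervB true Θ A → DervB true (Δ.fill [Item.fm A]) C →
      DervB true (Δ.fill Θ) C

/-! ## Bracket-free formulae and the calculi `!L1` and `!wL1` -/

/-- Bracket-free formulae (language of `!L1` / `!wL1`). -/
inductive Fm0 : Type
  | var : ℕ → Fm0
  | one : Fm0
  | ldiv : Fm0 → Fm0 → Fm0
  | rdiv : Fm0 → Fm0 → Fm0
  | mul : Fm0 → Fm0 → Fm0
  | bang : Fm0 → Fm0

/-- Derivability in `!L1` / `!wL1`.  The first boolean allows the weakening
rule (`DervL true` is `!wL1`, `DervL false` is `!L1`); the second boolean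
allows the rule (cut). -/
inductive DervL : Bool → Bool → List Fm0 → Fm0 → Prop
  | id (w cf : Bool) (A : Fm0) : DervL w cf [A] A
  | one_r (w cf : Bool) : DervL w cf [] Fm0.one
  | rdiv_l (w cf : Bool) (Γ Δ₁ Δ₂ : List Fm0) (B C D : Fm0) :
      DervL w cf Γ B → DervL w cf (Δ₁ ++ C :: Δ₂) D →
      DervL w cf (Δ₁ ++ Fm0.rdiv C B :: (Γ ++ Δ₂)) D
  | rdiv_r (w cf : Bool) (Γ : List Fm0) (B C : Fm0) :
      DervL w cf (Γ ++ [B]) C → DervL w cf Γ (Fm0.rdiv C B)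
  | ldiv_l (w cf : Bool) (Γ Δ₁ Δ₂ : List Fm0) (A C D : Fm0) :
      DervL w cf Γ A → DervL w cf (Δ₁ ++ C :: Δ₂) D →
      DervL w cf (Δ₁ ++ Γ ++ Fm0.ldiv A C :: Δ₂) D
  | ldiv_r (w cf : Bool) (Γ : List Fm0) (A C : Fm0) :
      DervL w cf (A :: Γ) C → DervL w cf Γ (Fm0.ldiv A C)
  | mul_l (w cf : Bool) (Δ₁ Δ₂ : List Fm0) (A B D : Fm0) :
      DervL w cf (Δ₁ ++ A :: B :: Δ₂) D → DervL w cf (Δ₁ ++ Fm0.mul A B :: Δ₂) D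
  | mul_r (w cf : Bool) (Γ₁ Γ₂ : List Fm0) (A B : Fm0) :
      DervL w cf Γ₁ A → DervL w cf Γ₂ B → DervL w cf (Γ₁ ++ Γ₂) (Fm0.mul A B)
  | one_l (w cf : Bool) (Δ₁ Δ₂ : List Fm0) (A : Fm0) :
      DervL w cf (Δ₁ ++ Δ₂) A → DervL w cf (Δ₁ ++ Fm0.one :: Δ₂) A
  | bang_l (w cf : Bool) (Δ₁ Δ₂ : List Fm0) (A B : Fm0) :
      DervL w cf (Δ₁ ++ A :: Δ₂) B → DervL w cf (Δ₁ ++ Fm0.bang A :: Δ₂) B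
  | bang_r (w cf : Bool) (Φ : List Fm0) (A : Fm0) :
      DervL w cf (Φ.map Fm0.bang) A → DervL w cf (Φ.map Fm0.bang) (Fm0.bang A)
  | perm1 (w cf : Bool) (Δ₁ Γ Δ₂ : List Fm0) (A B : Fm0) :
      DervL w cf (Δ₁ ++ Fm0.bang A :: (Γ ++ Δ₂)) B →
      DervL w cf (Δ₁ ++ Γ ++ Fm0.bang A :: Δ₂) B
  | perm2 (w cf : Bool) (Δ₁ Γ Δ₂ : List Fm0) (A B : Fm0) :
      DervL w cf (Δ₁ ++ Γ ++ Fm0.bang A :: Δ₂) B →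
      DervL w cf (Δ₁ ++ Fm0.bang A :: (Γ ++ Δ₂)) B
  | contr (w cf : Bool) (Δ₁ Δ₂ : List Fm0) (A B : Fm0) :
      DervL w cf (Δ₁ ++ Fm0.bang A :: Fm0.bang A :: Δ₂) B →
      DervL w cf (Δ₁ ++ Fm0.bang A :: Δ₂) B
  | weak (cf : Bool) (Δ₁ Δ₂ : List Fm0) (A B : Fm0) :
      DervL true cf (Δ₁ ++ Δ₂) B → DervL true cf (Δ₁ ++ Fm0.bang A :: Δ₂) B
  | cut (w : Bool) (Θ Δ₁ Δ₂ : List Fm0) (A C : Fm0) :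
      DervL w true Θ A → DervL w true (Δ₁ ++ A :: Δ₂) C →
      DervL w true (Δ₁ ++ Θ ++ Δ₂) C

/-! ## The Lambek calculus with unit `L1` and theories `L1 + T` -/

/-- Formulae of `L1` (no `!`, no bracket modalities). -/
inductive Fm1 : Type
  | var : ℕ → Fm1
  | one : Fm1
  | ldiv : Fm1 → Fm1 → Fm1
  | rdiv : Fm1 → Fm1 → Fm1
  | mul : Fm1 → Fm1 → Fm1

/-- Sequents of `L1`. -/
abbrev Seq1 := List Fm1 × Fm1

/-- Derivability in `L1 + T` (sequents of `T` are extra axioms). -/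
inductive DervT (T : Set Seq1) : List Fm1 → Fm1 → Prop
  | id (A : Fm1) : DervT T [A] A
  | one_r : DervT T [] Fm1.one
  | ax (Γ : List Fm1) (A : Fm1) : (Γ, A) ∈ T → DervT T Γ A
  | rdiv_l (Γ Δ₁ Δ₂ : List Fm1) (B C D : Fm1) :
      DervT T Γ B → DervT T (Δ₁ ++ C :: Δ₂) D →
      DervT T (Δ₁ ++ Fm1.rdiv C B :: (Γ ++ Δ₂)) D
  | rdiv_r (Γ : List Fm1) (B C : Fm1) :
      DervT T (Γ ++ [B]) C → DervT T Γ (Fm1.rdiv C B)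
  | ldiv_l (Γ Δ₁ Δ₂ : List Fm1) (A C D : Fm1) :
      DervT T Γ A → DervT T (Δ₁ ++ C :: Δ₂) D →
      DervT T (Δ₁ ++ Γ ++ Fm1.ldiv A C :: Δ₂) D
  | ldiv_r (Γ : List Fm1) (A C : Fm1) :
      DervT T (A :: Γ) C → DervT T Γ (Fm1.ldiv A C)
  | mul_l (Δ₁ Δ₂ : List Fm1) (A B D : Fm1) :
      DervT T (Δ₁ ++ A :: B :: Δ₂) D → DervT T (Δ₁ ++ Fm1.mul A B :: Δ₂) D
  | mul_r (Γ₁ Γ₂ : List Fm1) (A B : Fm1) :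
      DervT T Γ₁ A → DervT T Γ₂ B → DervT T (Γ₁ ++ Γ₂) (Fm1.mul A B)
  | one_l (Δ₁ Δ₂ : List Fm1) (A : Fm1) :
      DervT T (Δ₁ ++ Δ₂) A → DervT T (Δ₁ ++ Fm1.one :: Δ₂) A
  | cut (Θ Δ₁ Δ₂ : List Fm1) (A C : Fm1) :
      DervT T Θ A → DervT T (Δ₁ ++ A :: Δ₂) C →
      DervT T (Δ₁ ++ Θ ++ Δ₂) C

/-- Derivability in `L1 + T` where every application of (cut) must have a
sequent from `T` as one of its premises. -/
inductive DervTr (T : Set Seq1) : List Fm1 → Fm1 → Prop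
  | id (A : Fm1) : DervTr T [A] A
  | one_r : DervTr T [] Fm1.one
  | ax (Γ : List Fm1) (A : Fm1) : (Γ, A) ∈ T → DervTr T Γ A
  | rdiv_l (Γ Δ₁ Δ₂ : List Fm1) (B C D : Fm1) :
      DervTr T Γ B → DervTr T (Δ₁ ++ C :: Δ₂) D →
      DervTr T (Δ₁ ++ Fm1.rdiv C B :: (Γ ++ Δ₂)) D
  | rdiv_r (Γ : List Fm1) (B C : Fm1) :
      DervTr T (Γ ++ [B]) C → DervTr T Γ (Fm1.rdiv C B)
  | ldiv_l (Γ Δ₁ Δ₂ : List Fm1) (A C D : Fm1) :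
      DervTr T Γ A → DervTr T (Δ₁ ++ C :: Δ₂) D →
      DervTr T (Δ₁ ++ Γ ++ Fm1.ldiv A C :: Δ₂) D
  | ldiv_r (Γ : List Fm1) (A C : Fm1) :
      DervTr T (A :: Γ) C → DervTr T Γ (Fm1.ldiv A C)
  | mul_l (Δ₁ Δ₂ : List Fm1) (A B D : Fm1) :
      DervTr T (Δ₁ ++ A :: B :: Δ₂) D → DervTr T (Δ₁ ++ Fm1.mul A B :: Δ₂) D
  | mul_r (Γ₁ Γ₂ : List Fm1) (A B : Fm1) :
      DervTr T Γ₁ A → DervTr T Γ₂ B → DervTr T (Γ₁ ++ Γ₂) (Fm1.mul A B)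
  | one_l (Δ₁ Δ₂ : List Fm1) (A : Fm1) :
      DervTr T (Δ₁ ++ Δ₂) A → DervTr T (Δ₁ ++ Fm1.one :: Δ₂) A
  | cut (Θ Δ₁ Δ₂ : List Fm1) (A C : Fm1) :
      (Θ, A) ∈ T ∨ (Δ₁ ++ A :: Δ₂, C) ∈ T →
      DervTr T Θ A → DervTr T (Δ₁ ++ A :: Δ₂) C →
      DervTr T (Δ₁ ++ Θ ++ Δ₂) C

/-- Derivability in `L1 + T` by a derivation all of whose sequents satisfy
the predicate `Good`. -/
inductive DervTgood (T : Set Seq1) (Good : List Fm1 → Fm1 → Prop) : List Fm1 → Fm1 → Prop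
  | id (A : Fm1) : Good [A] A → DervTgood T Good [A] A
  | one_r : Good [] Fm1.one → DervTgood T Good [] Fm1.one
  | ax (Γ : List Fm1) (A : Fm1) : (Γ, A) ∈ T → Good Γ A → DervTgood T Good Γ A
  | rdiv_l (Γ Δ₁ Δ₂ : List Fm1) (B C D : Fm1) :
      DervTgood T Good Γ B → DervTgood T Good (Δ₁ ++ C :: Δ₂) D →
      Good (Δ₁ ++ Fm1.rdiv C B :: (Γ ++ Δ₂)) D →
      DervTgood T Good (Δ₁ ++ Fm1.rdiv C B :: (Γ ++ Δ₂)) D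
  | rdiv_r (Γ : List Fm1) (B C : Fm1) :
      DervTgood T Good (Γ ++ [B]) C → Good Γ (Fm1.rdiv C B) →
      DervTgood T Good Γ (Fm1.rdiv C B)
  | ldiv_l (Γ Δ₁ Δ₂ : List Fm1) (A C D : Fm1) :
      DervTgood T Good Γ A → DervTgood T Good (Δ₁ ++ C :: Δ₂) D →
      Good (Δ₁ ++ Γ ++ Fm1.ldiv A C :: Δ₂) D →
      DervTgood T Good (Δ₁ ++ Γ ++ Fm1.ldiv A C :: Δ₂) D
  | ldiv_r (Γ : List Fm1) (A C : Fm1) :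
      DervTgood T Good (A :: Γ) C → Good Γ (Fm1.ldiv A C) →
      DervTgood T Good Γ (Fm1.ldiv A C)
  | mul_l (Δ₁ Δ₂ : List Fm1) (A B D : Fm1) :
      DervTgood T Good (Δ₁ ++ A :: B :: Δ₂) D →
      Good (Δ₁ ++ Fm1.mul A B :: Δ₂) D →
      DervTgood T Good (Δ₁ ++ Fm1.mul A B :: Δ₂) D
  | mul_r (Γ₁ Γ₂ : List Fm1) (A B : Fm1) :
      DervTgood T Good Γ₁ A → DervTgood T Good Γ₂ B →
      Good (Γ₁ ++ Γ₂) (Fm1.mul A B) →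
      DervTgood T Good (Γ₁ ++ Γ₂) (Fm1.mul A B)
  | one_l (Δ₁ Δ₂ : List Fm1) (A : Fm1) :
      DervTgood T Good (Δ₁ ++ Δ₂) A → Good (Δ₁ ++ Fm1.one :: Δ₂) A →
      DervTgood T Good (Δ₁ ++ Fm1.one :: Δ₂) A
  | cut (Θ Δ₁ Δ₂ : List Fm1) (A C : Fm1) :
      DervTgood T Good Θ A → DervTgood T Good (Δ₁ ++ A :: Δ₂) C →
      Good (Δ₁ ++ Θ ++ Δ₂) C →
      DervTgood T Good (Δ₁ ++ Θ ++ Δ₂) C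

/-- The formula is built from primitive types using only the product `·`. -/
def ProdOnly : Fm1 → Prop
  | Fm1.var _ => True
  | Fm1.mul A B => ProdOnly A ∧ ProdOnly B
  | _ => False

/-- A sequent contains no occurrences of `\`, `/`, `1`. -/
def ProdOnlySeq (Γ : List Fm1) (A : Fm1) : Prop :=
  (∀ F ∈ Γ, ProdOnly F) ∧ ProdOnly A

/-! ## The bracket-forgetting projection -/

/-- BFP on formulae: delete all `⟨⟩` and `[]⁻¹`. -/
def fmBFP : Fm → Fm0
  | Fm.var n => Fm0.var n
  | Fm.one => Fm0.one
  | Fm.ldiv A B => Fm0.ldiv (fmBFP A) (fmBFP B)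
  | Fm.rdiv A B => Fm0.rdiv (fmBFP A) (fmBFP B)
  | Fm.mul A B => Fm0.mul (fmBFP A) (fmBFP B)
  | Fm.dia A => fmBFP A
  | Fm.binv A => fmBFP A
  | Fm.bang A => Fm0.bang (fmBFP A)

mutual
  /-- BFP on items. -/
  def itemBFP : Item → List Fm0
    | Item.fm A => [fmBFP A]
    | Item.br Γ => metaBFP Γ
  /-- BFP on meta-formulae: delete all brackets. -/
  def metaBFP : List Item → List Fm0
    | [] => []
    | i :: Γ => itemBFP i ++ metaBFP Γ
end

/-! ## Generative grammars (semi-Thue systems) -/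

/-- A generative grammar (semi-Thue system) over symbols coded by `ℕ`. -/
structure Grammar where
  nonterminals : Finset ℕ
  terminals : Finset ℕ
  disj : Disjoint nonterminals terminals
  start : ℕ
  start_mem : start ∈ nonterminals
  prods : Finset (List ℕ × List ℕ)
  prods_wf : ∀ p ∈ prods,
    (∀ c ∈ p.1, c ∈ nonterminals ∪ terminals) ∧
    (∀ c ∈ p.2, c ∈ nonterminals ∪ terminals)

/-- One rewriting step `η α θ ⇒_G η β θ`. -/
def Grammar.Step (G : Grammar) (x y : List ℕ) : Prop :=
  ∃ p ∈ G.prods, ∃ η θ : List ℕ, x = η ++ p.1 ++ θ ∧ y = η ++ p.2 ++ θ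

/-- `⇒*_G`: reflexive-transitive closure of `⇒_G`. -/
def Grammar.Derives (G : Grammar) : List ℕ → List ℕ → Prop :=
  Relation.ReflTransGen G.Step

/-- All productions of `G` have nonempty left- and right-hand sides. -/
def Grammar.NonemptySides (G : Grammar) : Prop :=
  ∀ p ∈ G.prods, p.1 ≠ [] ∧ p.2 ≠ []

/-! ### Encoding grammars into formulae -/

/-- `u₁ · … · u_k` as an `Fm`-formula (`1` for the empty word). -/
def wordFm : List ℕ → Fm
  | [] => Fm.one
  | [a] => Fm.var a
  | a :: b :: rest => Fm.mul (Fm.var a) (wordFm (b :: rest))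

/-- `u₁ · … · u_k` as an `Fm0`-formula. -/
def wordFm0 : List ℕ → Fm0
  | [] => Fm0.one
  | [a] => Fm0.var a
  | a :: b :: rest => Fm0.mul (Fm0.var a) (wordFm0 (b :: rest))

/-- `u₁ · … · u_k` as an `Fm1`-formula. -/
def wordFm1 : List ℕ → Fm1
  | [] => Fm1.one
  | [a] => Fm1.var a
  | a :: b :: rest => Fm1.mul (Fm1.var a) (wordFm1 (b :: rest))

/-- The formula `(u₁·…·u_k) / (v₁·…·v_m)` for a production `u ⇒ v`, in `Fm`. -/
def prodFm (p : List ℕ × List ℕ) : Fm := Fm.rdiv (wordFm p.1) (wordFm p.2)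

/-- The formula `(u₁·…·u_k) / (v₁·…·v_m)` for a production `u ⇒ v`, in `Fm0`. -/
def prodFm0 (p : List ℕ × List ℕ) : Fm0 := Fm0.rdiv (wordFm0 p.1) (wordFm0 p.2)

/-- `Γ_G = !B₁, …, !Bₙ` (bracket-free). -/
noncomputable def GammaG (G : Grammar) : List Fm0 :=
  G.prods.toList.map (fun p => Fm0.bang (prodFm0 p))

/-- `Φ_G = !(1 / !B₁), …, !(1 / !Bₙ)` (bracket-free). -/
noncomputable def PhiG (G : Grammar) : List Fm0 :=
  G.prods.toList.map (fun p => Fm0.bang (Fm0.rdiv Fm0.one (Fm0.bang (prodFm0 p))))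

/-- `Γ̃_G = ![]⁻¹B₁, …, ![]⁻¹Bₙ`. -/
noncomputable def GammaTG (G : Grammar) : Meta :=
  G.prods.toList.map (fun p => Item.fm (Fm.bang (Fm.binv (prodFm p))))

/-- `Φ̃_G = !(1 / ![]⁻¹B₁), …, !(1 / ![]⁻¹Bₙ)`. -/
noncomputable def PhiTG (G : Grammar) : Meta :=
  G.prods.toList.map
    (fun p => Item.fm (Fm.bang (Fm.rdiv Fm.one (Fm.bang (Fm.binv (prodFm p))))))

/-- The theory `T_G = { v₁, …, v_m → u₁·…·u_k : (u ⇒ v) ∈ P }`. -/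
def TG (G : Grammar) : Set Seq1 :=
  { q | ∃ p ∈ G.prods, q = (p.2.map Fm1.var, wordFm1 p.1) }

/-! ## Effective encodings of sequents into `ℕ` -/

/-- An effective injective code of `!bL1`-formulae. -/
def encFm : Fm → ℕ
  | Fm.var n => Nat.pair 0 n
  | Fm.one => Nat.pair 1 0
  | Fm.ldiv A B => Nat.pair 2 (Nat.pair (encFm A) (encFm B))
  | Fm.rdiv A B => Nat.pair 3 (Nat.pair (encFm A) (encFm B))
  | Fm.mul A B => Nat.pair 4 (Nat.pair (encFm A) (encFm B))
  | Fm.dia A => Nat.pair 5 (encFm A)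
  | Fm.binv A => Nat.pair 6 (encFm A)
  | Fm.bang A => Nat.pair 7 (encFm A)

mutual
  /-- An effective injective code of items. -/
  def encItem : Item → ℕ
    | Item.fm A => Nat.pair 0 (encFm A)
    | Item.br Γ => Nat.pair 1 (encMeta Γ)
  /-- An effective injective code of meta-formulae. -/
  def encMeta : List Item → ℕ
    | [] => 0
    | i :: Γ => Nat.pair (encItem i) (encMeta Γ) + 1
end

/-- An effective injective code of `!bL1`-sequents. -/
def encSeqB (Γ : Meta) (A : Fm) : ℕ := Nat.pair (encMeta Γ) (encFm A)

/-- An effective injective code of bracket-free formulae. -/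
def encFm0 : Fm0 → ℕ
  | Fm0.var n => Nat.pair 0 n
  | Fm0.one => Nat.pair 1 0
  | Fm0.ldiv A B => Nat.pair 2 (Nat.pair (encFm0 A) (encFm0 B))
  | Fm0.rdiv A B => Nat.pair 3 (Nat.pair (encFm0 A) (encFm0 B))
  | Fm0.mul A B => Nat.pair 4 (Nat.pair (encFm0 A) (encFm0 B))
  | Fm0.bang A => Nat.pair 5 (encFm0 A)

/-- An effective injective code of `!L1`/`!wL1`-sequents. -/
def encSeq0 (Γ : List Fm0) (A : Fm0) : ℕ :=
  Nat.pair ((Γ.map encFm0).foldr (fun a r => Nat.pair a r + 1) 0) (encFm0 A)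

/-! ## Sizes -/

/-- Size (number of symbols) of a formula. -/
def fmSize : Fm → ℕ
  | Fm.var _ => 1
  | Fm.one => 1
  | Fm.ldiv A B => fmSize A + fmSize B + 1
  | Fm.rdiv A B => fmSize A + fmSize B + 1
  | Fm.mul A B => fmSize A + fmSize B + 1
  | Fm.dia A => fmSize A + 1
  | Fm.binv A => fmSize A + 1
  | Fm.bang A => fmSize A + 1

mutual
  /-- Size of an item. -/
  def itemSize : Item → ℕ
    | Item.fm A => fmSize A
    | Item.br Γ => metaSize Γ + 1
  /-- Size of a meta-formula. -/
  def metaSize : List Item → ℕ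
    | [] => 0
    | i :: Γ => itemSize i + metaSize Γ
end

/-! ## Polarity and the bracket non-negative condition -/

/-- `cleanFm pol A`: the formula `A`, all of whose subformula occurrences have
their polarity in the sequent tracked starting from `pol` (`true` = positive),
contains no `[]⁻¹`-subformula at positive polarity and no `⟨⟩`-subformula at
negative polarity. -/
def cleanFm : Bool → Fm → Prop
  | _, Fm.var _ => True
  | _, Fm.one => True
  | pol, Fm.ldiv A B => cleanFm (!pol) A ∧ cleanFm pol B
  | pol, Fm.rdiv B A => cleanFm pol B ∧ cleanFm (!pol) A
  | pol, Fm.mul A B => cleanFm pol A ∧ cleanFm pol B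
  | pol, Fm.dia A => pol = true ∧ cleanFm pol A
  | pol, Fm.binv A => pol = false ∧ cleanFm pol A
  | pol, Fm.bang A => cleanFm pol A

/-- `bnnFm pol A`: every negative occurrence of a `!`-subformula of `A`
(where `A` itself occurs at polarity `pol` in the sequent) includes no
positive occurrence of `[]⁻¹C` and no negative occurrence of `⟨⟩C`. -/
def bnnFm : Bool → Fm → Prop
  | _, Fm.var _ => True
  | _, Fm.one => True
  | pol, Fm.ldiv A B => bnnFm (!pol) A ∧ bnnFm pol B
  | pol, Fm.rdiv B A => bnnFm pol B ∧ bnnFm (!pol) A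
  | pol, Fm.mul A B => bnnFm pol A ∧ bnnFm pol B
  | pol, Fm.dia A => bnnFm pol A
  | pol, Fm.binv A => bnnFm pol A
  | pol, Fm.bang A => (pol = false → cleanFm false A) ∧ bnnFm pol A

mutual
  /-- The bracket non-negative condition for an item of an antecedent. -/
  def bnnItem : Item → Prop
    | Item.fm A => bnnFm false A
    | Item.br Γ => bnnMeta Γ
  /-- The bracket non-negative condition for an antecedent. -/
  def bnnMeta : List Item → Prop
    | [] => True
    | i :: Γ => bnnItem i ∧ bnnMeta Γ
end

/-- The sequent `Γ → C` obeys the bracket non-negative condition. -/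
def bnnSeq (Γ : Meta) (C : Fm) : Prop := bnnMeta Γ ∧ bnnFm true C

/-! ## The formulation of `!bL1` with the generalized permutation rule -/

/-- `interleave Δ₀ [(A₁,Δ₁), …, (A_k,Δ_k)] = Δ₀, !A₁, Δ₁, …, !A_k, Δ_k`. -/
def interleave : Meta → List (Fm × Meta) → Meta
  | Δ₀, [] => Δ₀
  | Δ₀, (A, Δ) :: rest => Δ₀ ++ Item.fm (Fm.bang A) :: interleave Δ rest

/-- Derivations in the formulation of `!bL1` in which `(perm₁)`, `(perm₂)` are
replaced by the generalized permutation rule `(perm)*`.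
`NDervP cf b n Γ C` means: there is a derivation of `Γ → C` in which
(cut) is allowed only if `cf = true`, no two applications of `(perm)*` are
consecutive, `b` records whether the last rule applied is `(perm)*`, and the
derivation has exactly `n` rule applications (axiom instances included). -/
inductive NDervP : Bool → Bool → ℕ → Meta → Fm → Prop
  | id (cf : Bool) (A : Fm) : NDervP cf false 1 [Item.fm A] A
  | one_r (cf : Bool) : NDervP cf false 1 [] Fm.one
  | rdiv_l (cf b₁ b₂ : Bool) (n₁ n₂ : ℕ) (Δ : Ctx) (Γ : Meta) (B C D : Fm) :
      NDervP cf b₁ n₁ Γ B → NDervP cf b₂ n₂ (Δ.fill [Item.fm C]) D →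
      NDervP cf false (n₁ + n₂ + 1) (Δ.fill (Item.fm (Fm.rdiv C B) :: Γ)) D
  | rdiv_r (cf b : Bool) (n : ℕ) (Γ : Meta) (B C : Fm) :
      NDervP cf b n (Γ ++ [Item.fm B]) C → NDervP cf false (n + 1) Γ (Fm.rdiv C B)
  | ldiv_l (cf b₁ b₂ : Bool) (n₁ n₂ : ℕ) (Δ : Ctx) (Γ : Meta) (A C D : Fm) :
      NDervP cf b₁ n₁ Γ A → NDervP cf b₂ n₂ (Δ.fill [Item.fm C]) D →
      NDervP cf false (n₁ + n₂ + 1) (Δ.fill (Γ ++ [Item.fm (Fm.ldiv A C)])) D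
  | ldiv_r (cf b : Bool) (n : ℕ) (Γ : Meta) (A C : Fm) :
      NDervP cf b n (Item.fm A :: Γ) C → NDervP cf false (n + 1) Γ (Fm.ldiv A C)
  | mul_l (cf b : Bool) (n : ℕ) (Δ : Ctx) (A B D : Fm) :
      NDervP cf b n (Δ.fill [Item.fm A, Item.fm B]) D →
      NDervP cf false (n + 1) (Δ.fill [Item.fm (Fm.mul A B)]) D
  | mul_r (cf b₁ b₂ : Bool) (n₁ n₂ : ℕ) (Γ₁ Γ₂ : Meta) (A B : Fm) :
      NDervP cf b₁ n₁ Γ₁ A → NDervP cf b₂ n₂ Γ₂ B →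
      NDervP cf false (n₁ + n₂ + 1) (Γ₁ ++ Γ₂) (Fm.mul A B)
  | one_l (cf b : Bool) (n : ℕ) (Δ : Ctx) (A : Fm) :
      NDervP cf b n (Δ.fill []) A → NDervP cf false (n + 1) (Δ.fill [Item.fm Fm.one]) A
  | dia_l (cf b : Bool) (n : ℕ) (Δ : Ctx) (A C : Fm) :
      NDervP cf b n (Δ.fill [Item.br [Item.fm A]]) C →
      NDervP cf false (n + 1) (Δ.fill [Item.fm (Fm.dia A)]) C
  | dia_r (cf b : Bool) (n : ℕ) (Θ : Meta) (A : Fm) :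
      NDervP cf b n Θ A → NDervP cf false (n + 1) [Item.br Θ] (Fm.dia A)
  | binv_l (cf b : Bool) (n : ℕ) (Δ : Ctx) (A C : Fm) :
      NDervP cf b n (Δ.fill [Item.fm A]) C →
      NDervP cf false (n + 1) (Δ.fill [Item.br [Item.fm (Fm.binv A)]]) C
  | binv_r (cf b : Bool) (n : ℕ) (Θ : Meta) (A : Fm) :
      NDervP cf b n [Item.br Θ] A → NDervP cf false (n + 1) Θ (Fm.binv A)
  | bang_l (cf b : Bool) (n : ℕ) (Δ : Ctx) (A B : Fm) :
      NDervP cf b n (Δ.fill [Item.fm A]) B →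
      NDervP cf false (n + 1) (Δ.fill [Item.fm (Fm.bang A)]) B
  | bang_r (cf b : Bool) (n : ℕ) (Φ : List Fm) (A : Fm) :
      NDervP cf b n (bangs Φ) A → NDervP cf false (n + 1) (bangs Φ) (Fm.bang A)
  | contr (cf b : Bool) (n : ℕ) (Δ : Ctx) (Φ : List Fm) (Γ : Meta) (B : Fm) :
      Φ ≠ [] →
      NDervP cf b n (Δ.fill (bangs Φ ++ [Item.br (bangs Φ ++ Γ)])) B →
      NDervP cf false (n + 1) (Δ.fill (bangs Φ ++ Γ)) B
  | permStar (cf : Bool) (n : ℕ) (Δ : Ctx) (Δ₀ : Meta) (L L' : List (Fm × Meta)) (C : Fm) :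
      L.map Prod.snd = L'.map Prod.snd →
      (L.map Prod.fst).Perm (L'.map Prod.fst) →
      NDervP cf false n (Δ.fill (interleave Δ₀ L)) C →
      NDervP cf true (n + 1) (Δ.fill (interleave Δ₀ L')) C
  | cut (b₁ b₂ : Bool) (n₁ n₂ : ℕ) (Δ : Ctx) (Θ : Meta) (A C : Fm) :
      NDervP true b₁ n₁ Θ A → NDervP true b₂ n₂ (Δ.fill [Item.fm A]) C →
      NDervP true false (n₁ + n₂ + 1) (Δ.fill Θ) C

/-! ## Relational semantics of `!wL1` -/

section Relational

variable {X : Type*}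

/-- Interpretation of formulae as binary relations; the rightmost factor of a product acts
first, and `!A` is the identity if `A` is reflexive and empty otherwise. -/
def Fm0.rel (V : ℕ → X → X → Prop) : Fm0 → X → X → Prop
  | Fm0.var n => V n
  | Fm0.one => fun x y => x = y
  | Fm0.ldiv A C => fun x z => ∀ y, A.rel V z y → C.rel V x y
  | Fm0.rdiv C B => fun z y => ∀ x, B.rel V x z → C.rel V x y
  | Fm0.mul A B => fun x y => ∃ z, B.rel V x z ∧ A.rel V z y
  | Fm0.bang A => fun x y => x = y ∧ ∀ z, A.rel V z z

/-- Composition of a sequence of relations, the last one acting first. -/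
def compRel {ι : Type*} (r : ι → X → X → Prop) : List ι → X → X → Prop
  | [] => fun x y => x = y
  | a :: l => fun x y => ∃ z, compRel r l x z ∧ r a z y

theorem compRel_append {ι : Type*} (r : ι → X → X → Prop) (l m : List ι) (x y : X) :
    compRel r (l ++ m) x y ↔ ∃ z, compRel r m x z ∧ compRel r l z y := by
  induction l generalizing y with
  | nil => simp [compRel]
  | cons a l ih =>
    simp only [List.cons_append, compRel, ih]
    constructor
    · rintro ⟨z, ⟨t, h1, h2⟩, h3⟩
      exact ⟨t, h1, z, h2, h3⟩
    · rintro ⟨t, h1, z, h2, h3⟩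
      exact ⟨z, ⟨t, h1, h2⟩, h3⟩

theorem compRel_map {ι κ : Type*} (r : κ → X → X → Prop) (f : ι → κ) (l : List ι) :
    compRel r (l.map f) = compRel (fun i => r (f i)) l := by
  induction l with
  | nil => rfl
  | cons a l ih => simp only [List.map_cons, compRel, ih]

theorem compRel_bang_iff (V : ℕ → X → X → Prop) (Φ : List Fm0) (x y : X) :
    compRel (Fm0.rel V) (Φ.map Fm0.bang) x y ↔ x = y ∧ ∀ A ∈ Φ, ∀ z, A.rel V z z := by
  induction Φ generalizing y with
  | nil => simp [compRel]
  | cons A Φ ih =>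
    simp only [List.map_cons, compRel, ih, Fm0.rel, List.forall_mem_cons]
    grind

/-- Soundness of `!wL1` with cut in the relational semantics. -/
theorem DervL.sound (V : ℕ → X → X → Prop) {w cf : Bool} {Γ : List Fm0} {A : Fm0}
    (h : DervL w cf Γ A) {x y : X} (hxy : compRel (Fm0.rel V) Γ x y) : A.rel V x y := by
  induction h generalizing x y with
  | id => simpa [compRel] using hxy
  | one_r => exact hxy
  | rdiv_l w cf Γ Δ₁ Δ₂ B C D _ _ ih₁ ih₂ =>
    simp only [compRel_append, compRel, Fm0.rel] at hxy ih₂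
    grind
  | rdiv_r w cf Γ B C _ ih =>
    simp only [compRel_append, compRel, Fm0.rel] at ih ⊢
    grind
  | ldiv_l w cf Γ Δ₁ Δ₂ A C D _ _ ih₁ ih₂ =>
    simp only [compRel_append, compRel, Fm0.rel] at hxy ih₂
    grind
  | ldiv_r w cf Γ A C _ ih =>
    simp only [compRel, Fm0.rel] at ih ⊢
    grind
  | mul_l w cf Δ₁ Δ₂ A B D _ ih =>
    simp only [compRel_append, compRel, Fm0.rel] at hxy ih
    grind
  | mul_r w cf Γ₁ Γ₂ A B _ _ ih₁ ih₂ =>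
    simp only [compRel_append, Fm0.rel] at hxy ⊢
    grind
  | one_l w cf Δ₁ Δ₂ A _ ih =>
    simp only [compRel_append, compRel, Fm0.rel] at hxy ih
    grind
  | bang_l w cf Δ₁ Δ₂ A B _ ih =>
    simp only [compRel_append, compRel, Fm0.rel] at hxy ih
    obtain ⟨z, ⟨_, h₁, rfl, hA⟩, h₂⟩ := hxy
    exact ih ⟨_, ⟨_, h₁, hA _⟩, h₂⟩
  | bang_r w cf Φ A _ ih =>
    simp only [compRel_bang_iff, Fm0.rel] at hxy ih ⊢
    grind
  | perm1 w cf Δ₁ Γ Δ₂ A B _ ih =>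
    simp only [compRel_append, compRel, Fm0.rel] at hxy ih
    grind
  | perm2 w cf Δ₁ Γ Δ₂ A B _ ih =>
    simp only [compRel_append, compRel, Fm0.rel] at hxy ih
    grind
  | contr w cf Δ₁ Δ₂ A B _ ih =>
    simp only [compRel_append, compRel, Fm0.rel] at hxy ih
    grind
  | weak cf Δ₁ Δ₂ A B _ ih =>
    simp only [compRel_append, compRel, Fm0.rel] at hxy ih
    grind
  | cut w Θ Δ₁ Δ₂ A C _ _ ih₁ ih₂ =>
    simp only [compRel_append, compRel] at hxy ih₂
    grind

theorem rel_wordFm0 (V : ℕ → X → X → Prop) (l : List ℕ) :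
    (wordFm0 l).rel V = compRel V l := by
  match l with
  | [] => rfl
  | [a] => simp [wordFm0, compRel, Fm0.rel]
  | a :: b :: l => simp only [wordFm0, Fm0.rel, compRel, rel_wordFm0 V (b :: l)]

end Relational

/-! ## Rewriting systems inside `!wL1` -/

section Rewriting

variable {ι : Type*}

/-- `Rewrites R u v`: the word `u` rewrites to `v` by finitely many applications of the
rules `p.1 ⇒ p.2`, `p ∈ R`. -/
inductive Rewrites (R : List (List ι × List ι)) : List ι → List ι → Prop
  | refl (u : List ι) : Rewrites R u u
  | head (u v w : List ι) (p : List ι × List ι) (hp : p ∈ R) :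
      Rewrites R (u ++ p.2 ++ v) w → Rewrites R (u ++ p.1 ++ v) w

namespace Rewrites

variable {R : List (List ι × List ι)} {u v w : List ι}

theorem trans (h₁ : Rewrites R u v) (h₂ : Rewrites R v w) : Rewrites R u w := by
  induction h₁ with
  | refl => exact h₂
  | head a b c p hp _ ih => exact head a b w p hp (ih h₂)

theorem append_left (h : Rewrites R u v) (a : List ι) : Rewrites R (a ++ u) (a ++ v) := by
  induction h with
  | refl => exact refl _
  | head b c d p hp _ ih =>
    simpa only [List.append_assoc] using
      head (a ++ b) c (a ++ d) p hp (by simpa only [List.append_assoc] using ih)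

theorem cons (h : Rewrites R u v) (a : ι) : Rewrites R (a :: u) (a :: v) :=
  h.append_left [a]

theorem rule {p : List ι × List ι} (hp : p ∈ R) (a : List ι) :
    Rewrites R (p.1 ++ a) (p.2 ++ a) := by
  simpa using head [] a _ p hp (refl _)

end Rewrites

/-- Antecedent formulae encoding the rules `R` over symbols numbered by `e`. -/
def ruleFms (e : ι → ℕ) (R : List (List ι × List ι)) : List Fm0 :=
  R.map (fun p => prodFm0 (p.2.map e, p.1.map e))

/-- A word over symbols numbered by `e` as a sequence of primitive types. -/
def wordSeq (e : ι → ℕ) (u : List ι) : List Fm0 :=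
  u.map (fun a => Fm0.var (e a))

theorem wordSeq_append (e : ι → ℕ) (u v : List ι) :
    wordSeq e (u ++ v) = wordSeq e u ++ wordSeq e v := List.map_append

theorem DervL.wordFm0_left {w cf : Bool} {A : Fm0} (l : List ℕ) {Δ₁ Δ₂ : List Fm0}
    (h : DervL w cf (Δ₁ ++ l.map Fm0.var ++ Δ₂) A) : DervL w cf (Δ₁ ++ wordFm0 l :: Δ₂) A := by
  match l with
  | [] => exact .one_l w cf _ _ _ (by simpa using h)
  | [a] => simpa [wordFm0] using h
  | a :: b :: l =>
    refine .mul_l w cf _ _ _ _ _ ?_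
    have := wordFm0_left (Δ₁ := Δ₁ ++ [Fm0.var a]) (Δ₂ := Δ₂) (A := A) (b :: l)
      (by simpa using h)
    simpa using this

theorem DervL.wordFm0_right {w cf : Bool} (l : List ℕ) :
    DervL w cf (l.map Fm0.var) (wordFm0 l) := by
  match l with
  | [] => exact .one_r w cf
  | [a] => exact .id w cf _
  | a :: b :: l =>
    exact .mul_r w cf [Fm0.var a] _ _ _ (.id w cf _) (wordFm0_right (b :: l))

theorem DervL.bang_of_mem {w cf : Bool} {Φ Δ₁ Δ₂ : List Fm0} {A B : Fm0} (hA : A ∈ Φ)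
    (h : DervL w cf (Φ.map Fm0.bang ++ Δ₁ ++ A :: Δ₂) B) :
    DervL w cf (Φ.map Fm0.bang ++ Δ₁ ++ Δ₂) B := by
  obtain ⟨Φ₁, Φ₂, rfl⟩ := List.append_of_mem hA
  have h₁ := DervL.bang_l w cf _ _ _ _ h
  have h₂ := DervL.perm2 w cf (Φ₁.map Fm0.bang) (Fm0.bang A :: (Φ₂.map Fm0.bang ++ Δ₁)) Δ₂ A B
    (by simpa using h₁)
  simpa using DervL.contr w cf _ _ _ _ h₂

theorem Rewrites.dervL {w cf : Bool} {e : ι → ℕ} {R : List (List ι × List ι)} {u v : List ι}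
    (h : Rewrites R u v) {A : Fm0}
    (hv : DervL w cf ((ruleFms e R).map Fm0.bang ++ wordSeq e v) A) :
    DervL w cf ((ruleFms e R).map Fm0.bang ++ wordSeq e u) A := by
  induction h with
  | refl => exact hv
  | head a b c p hp _ ih =>
    have hmem : prodFm0 (p.2.map e, p.1.map e) ∈ ruleFms e R := List.mem_map_of_mem hp
    rw [List.append_assoc, wordSeq_append, ← List.append_assoc]
    refine DervL.bang_of_mem hmem ?_
    rw [wordSeq_append]
    refine DervL.rdiv_l w cf _ _ _ _ _ _ ?_ (DervL.wordFm0_left _ ?_)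
    · simpa [wordSeq, Function.comp_def] using DervL.wordFm0_right (p.1.map e)
    · simpa [wordSeq, Function.comp_def] using ih hv

theorem DervL.bangs_one (cf : Bool) (Φ : List Fm0) :
    DervL true cf (Φ.map Fm0.bang) Fm0.one := by
  induction Φ with
  | nil => exact .one_r _ _
  | cons A Φ ih => exact .weak cf [] _ A _ ih

/-- If the rules `R` are valid under a relational interpretation `r` of the symbols, then
every word derivable as `1` denotes a subrelation of the identity. -/
theorem DervL.word_sound {X : Type*} {e : ι → ℕ} (he : Function.Injective e)
    (r : ι → X → X → Prop) {R : List (List ι × List ι)}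
    (hR : ∀ p ∈ R, ∀ x y, compRel r p.1 x y → compRel r p.2 x y) {w cf : Bool} {u : List ι}
    (h : DervL w cf ((ruleFms e R).map Fm0.bang ++ wordSeq e u) Fm0.one) {x y : X}
    (hxy : compRel r u x y) : x = y := by
  set V : ℕ → X → X → Prop := fun n x y => ∃ a, e a = n ∧ r a x y with hV
  have hVe : (fun a => V (e a)) = r := by
    funext a x y
    refine propext ⟨?_, fun h => ⟨a, rfl, h⟩⟩
    rintro ⟨b, hb, hr⟩
    exact he hb ▸ hr
  have hword (l : List ι) : compRel V (l.map e) = compRel r l := by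
    rw [compRel_map, hVe]
  refine h.sound V ((compRel_append _ _ _ _ _).2 ⟨y, ?_, (compRel_bang_iff _ _ _ _).2 ⟨rfl, ?_⟩⟩)
  · rw [wordSeq, compRel_map]
    simpa only [Fm0.rel, hVe] using hxy
  · simp only [ruleFms, List.mem_map]
    rintro _ ⟨p, hp, rfl⟩ z x hx
    rw [rel_wordFm0, hword] at hx ⊢
    exact hR p hp _ _ hx

end Rewriting

/-! ## A stack machine for partial recursive functions as a rewriting system -/

open Turing.ToPartrec (Code)

/-- Instructions acting on a stack of lists of natural numbers: `nil` pushes the empty list,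
`one` increments the first entry of the top list, `sep` prepends `0` to it, `head` replaces the
two top lists `v, w` by `v.headI :: w`, `run c` evaluates `c` on the top list, `loop c` performs
the test of the loop `c.fix`, and `hat a` performs `a` below the top list. -/
inductive Instr : Type
  | nil : Instr
  | one : Instr
  | sep : Instr
  | dup : Instr
  | pop : Instr
  | head : Instr
  | run : Code → Instr
  | loop : Code → Instr
  | hat : Instr → Instr

/-- An injective numbering of codes. -/
def codeNum : Code → ℕ
  | .zero' => Nat.pair 0 0
  | .succ => Nat.pair 1 0
  | .tail => Nat.pair 2 0
  | .cons f g => Nat.pair 3 (Nat.pair (codeNum f) (codeNum g))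
  | .comp f g => Nat.pair 4 (Nat.pair (codeNum f) (codeNum g))
  | .case f g => Nat.pair 5 (Nat.pair (codeNum f) (codeNum g))
  | .fix f => Nat.pair 6 (codeNum f)

theorem codeNum_injective : Function.Injective codeNum := by
  intro c d h
  induction c generalizing d <;> cases d <;> simp_all [codeNum, Nat.pair_eq_pair] <;> grind

namespace Instr

/-- An injective numbering of instructions. -/
def num : Instr → ℕ
  | nil => Nat.pair 0 0
  | one => Nat.pair 1 0
  | sep => Nat.pair 2 0
  | dup => Nat.pair 3 0
  | pop => Nat.pair 4 0
  | head => Nat.pair 5 0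
  | run c => Nat.pair 6 (codeNum c)
  | loop c => Nat.pair 7 (codeNum c)
  | hat a => Nat.pair 8 a.num

theorem num_injective : Function.Injective num := by
  intro a b h
  induction a generalizing b <;> cases b <;>
    simp_all [num, Nat.pair_eq_pair, codeNum_injective.eq_iff]
  grind

/-- States of the machine; `none` stands for divergence. -/
abbrev State := Option (List (List ℕ))

/-- Application of a partial function to the top of the stack. -/
def runRel (g : List ℕ → Part (List ℕ)) : State → State → Prop
  | none, y => y = none
  | some [], _ => False
  | some (v :: s), y => (∃ w ∈ g v, y = some (w :: s)) ∨ (¬ (g v).Dom ∧ y = none)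

/-- The partial function performed by `loop c`. -/
def loopFun (c : Code) (v : List ℕ) : Part (List ℕ) :=
  if v.headI = 0 then pure v.tail else c.fix.eval v.tail

/-- The transition relation of an instruction. -/
def rel : Instr → State → State → Prop
  | nil => fun x y => y = x.map ([] :: ·)
  | one => fun x y => match x with
    | none => y = none
    | some ((n :: v) :: s) => y = some (((n + 1) :: v) :: s)
    | _ => False
  | sep => runRel fun v => pure (0 :: v)
  | dup => fun x y => match x with
    | none => y = none
    | some (v :: s) => y = some (v :: v :: s)
    | _ => False
  | pop => fun x y => match x with
    | none => y = none
    | some (_ :: s) => y = some s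
    | _ => False
  | head => fun x y => match x with
    | none => y = none
    | some (v :: w :: s) => y = some ((v.headI :: w) :: s)
    | _ => False
  | run c => runRel c.eval
  | loop c => runRel (loopFun c)
  | hat a => fun x y => match x with
    | none => y = none
    | some (v :: s) => ∃ t, a.rel (some s) t ∧ y = t.map (v :: ·)
    | _ => False

theorem rel_none (a : Instr) (y : State) : a.rel none y ↔ y = none := by
  cases a <;> simp [rel, runRel]

theorem runRel_pure (g : List ℕ → List ℕ) (v : List ℕ) (s : List (List ℕ)) (y : State) :
    runRel (fun v => pure (g v)) (some (v :: s)) y ↔ y = some (g v :: s) := by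
  simp [runRel, Part.pure_eq_some]

theorem runRel_bind {g h : List ℕ → Part (List ℕ)} {x y : State}
    (H : runRel (fun v => (g v).bind h) x y) : ∃ z, runRel g x z ∧ runRel h z y := by
  match x with
  | none => exact ⟨none, rfl, H⟩
  | some [] => exact H.elim
  | some (v :: s) =>
    by_cases hg : (g v).Dom
    · refine ⟨some ((g v).get hg :: s), Or.inl ⟨_, Part.get_mem hg, rfl⟩, ?_⟩
      have : (g v).bind h = h ((g v).get hg) :=
        Part.bind_of_mem (Part.get_mem hg) h
      simpa only [runRel, this] using H
    · refine ⟨none, Or.inr ⟨hg, rfl⟩, ?_⟩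
      rcases H with ⟨w, hw, _⟩ | ⟨_, rfl⟩
      · obtain ⟨u, hu, _⟩ := Part.mem_bind_iff.1 hw
        exact (hg (Part.dom_iff_mem.2 ⟨u, hu⟩)).elim
      · rfl

theorem fix_eval_eq_bind (c : Code) (v : List ℕ) :
    c.fix.eval v = (c.eval v).bind (loopFun c) := by
  ext w
  rw [Code.fix_eval]
  refine PFun.mem_fix_iff.trans (Iff.trans ?_ Part.mem_bind_iff.symm)
  simp only [Part.mem_map_iff, loopFun, Code.fix_eval]
  constructor
  · rintro (⟨u, hu, h⟩ | ⟨_, ⟨u, hu, h⟩, h'⟩)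
    · refine ⟨u, hu, ?_⟩
      split_ifs at h ⊢
      simpa [Part.pure_eq_some, eq_comm] using h
    · refine ⟨u, hu, ?_⟩
      split_ifs at h ⊢
      obtain rfl := Sum.inr.inj h
      exact h'
  · rintro ⟨u, hu, h⟩
    split_ifs at h with h0
    · refine Or.inl ⟨u, hu, ?_⟩
      simpa [h0, Part.pure_eq_some, eq_comm] using h
    · exact Or.inr ⟨u.tail, ⟨u, hu, by simp [h0]⟩, h⟩

/-- Rules moving `hat a` through a list. -/
def hatRules (a : Instr) : List (List Instr × List Instr) :=
  [([hat a, one], [one, hat a]), ([hat a, sep], [sep, hat a]), ([hat a, nil], [nil, a])]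

/-- Rules for the instructions handling data. -/
def baseRules : List (List Instr × List Instr) :=
  hatRules one ++ hatRules sep ++
  [([dup, one], [one, hat one, dup]), ([dup, sep], [sep, hat sep, dup]), ([dup, nil], [nil, nil]),
    ([pop, one], [pop]), ([pop, sep], [pop]), ([pop, nil], []),
    ([head, one], [one, head]), ([head, sep], [sep, pop]), ([head, nil], [sep])]

/-- Rules for dropping the first entry of a list. -/
def tailRules : List (List Instr × List Instr) :=
  [([run .tail, one], [run .tail]), ([run .tail, sep], []), ([run .tail, nil], [nil])]

/-- Rules evaluating a code and its subcodes. -/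
def codeRules : Code → List (List Instr × List Instr)
  | .zero' => [([run .zero'], [sep])]
  | .succ => [([run .succ, one], [one, run .succ]), ([run .succ, sep], [one, sep, nil, pop]),
      ([run .succ, nil], [one, sep, nil])]
  | .tail => tailRules
  | .cons f g => ([run (.cons f g)], [head, run f, hat (run g), dup]) ::
      (hatRules (run g) ++ codeRules f ++ codeRules g)
  | .comp f g => ([run (.comp f g)], [run f, run g]) :: (codeRules f ++ codeRules g)
  | .case f g => ([run (.case f g), one], [run g]) :: ([run (.case f g), sep], [run f]) ::
      ([run (.case f g), nil], [run f, nil]) :: (codeRules f ++ codeRules g)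
  | .fix f => ([run (.fix f)], [loop f, run f]) :: ([loop f, one], [run (.fix f), run .tail]) ::
      ([loop f, sep], []) :: ([loop f, nil], [nil]) :: (tailRules ++ codeRules f)

/-- A rule is valid if its left-hand side denotes a subrelation of its right-hand side. -/
def Valid (p : List Instr × List Instr) : Prop :=
  ∀ x y, compRel rel p.1 x y → compRel rel p.2 x y

theorem hatRules_valid (a : Instr) : ∀ p ∈ hatRules a, Valid p := by
  simp only [hatRules, List.forall_mem_cons, Valid, compRel]
  refine ⟨?_, ?_, ?_, by simp⟩
  all_goals
    rintro (_ | _ | ⟨_ | ⟨n, v⟩, s⟩) y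
    all_goals simp [rel, rel_none, runRel, Part.pure_eq_some]
    all_goals rintro (_ | t) ht rfl <;> exact ⟨_, ht, by simp⟩

theorem baseRules_valid : ∀ p ∈ baseRules, Valid p := by
  simp only [baseRules, List.forall_mem_append]
  refine ⟨⟨hatRules_valid _, hatRules_valid _⟩, ?_⟩
  simp only [List.forall_mem_cons, Valid, compRel]
  refine ⟨?_, ?_, ?_, ?_, ?_, ?_, ?_, ?_, ?_, by simp⟩
  all_goals
    rintro (_ | _ | ⟨_ | ⟨n, v⟩, _ | ⟨w, s⟩⟩) y
    all_goals simp [rel, runRel, Part.pure_eq_some]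
    all_goals exact Eq.symm

theorem tailRules_valid : ∀ p ∈ tailRules, Valid p := by
  simp only [tailRules, List.forall_mem_cons, Valid, compRel]
  refine ⟨?_, ?_, ?_, by simp⟩
  all_goals
    rintro (_ | _ | ⟨_ | ⟨n, v⟩, s⟩) y
    all_goals simp [rel, runRel, Part.pure_eq_some]
    all_goals exact Eq.symm

theorem codeRules_valid (c : Code) : ∀ p ∈ codeRules c, Valid p := by
  induction c with
  | zero' =>
    simp only [codeRules, List.forall_mem_cons, Valid, compRel]
    exact ⟨by simp [rel], by simp⟩
  | succ =>
    simp only [codeRules, List.forall_mem_cons, Valid, compRel]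
    refine ⟨?_, ?_, ?_, by simp⟩
    all_goals
      rintro (_ | _ | ⟨_ | ⟨n, v⟩, s⟩) y
      all_goals simp [rel, runRel, Part.pure_eq_some]
  | tail => exact tailRules_valid
  | cons f g ihf ihg =>
    simp only [codeRules, List.forall_mem_cons, List.forall_mem_append]
    refine ⟨?_, ⟨hatRules_valid _, ihf⟩, ihg⟩
    rintro (_ | _ | ⟨v, s⟩) y
    · simp [compRel, rel, runRel]
    · simp [compRel, rel, runRel]
    · rintro ⟨_, rfl, h⟩
      suffices ∃ z t, compRel rel [hat (run g)] (some (v :: v :: s)) t ∧ runRel f.eval t z ∧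
          head.rel z y by
        obtain ⟨z, t, ⟨_, rfl, h₁⟩, h₂, h₃⟩ := this
        exact ⟨z, ⟨t, ⟨_, ⟨_, rfl, rfl⟩, h₁⟩, h₂⟩, h₃⟩
      by_cases hg : (g.eval v).Dom
      · have hg' : (rel (hat (run g))) (some (v :: v :: s)) (some (v :: (g.eval v).get hg :: s)) :=
          ⟨_, Or.inl ⟨_, Part.get_mem hg, rfl⟩, rfl⟩
        by_cases hf : (f.eval v).Dom
        · refine ⟨_, _, ⟨_, rfl, hg'⟩, Or.inl ⟨_, Part.get_mem hf, rfl⟩, ?_⟩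
          rcases h with ⟨w, hw, rfl⟩ | ⟨hd, rfl⟩
          · simp only [Code.cons_eval, Part.bind_eq_bind, Part.mem_bind_iff, Part.pure_eq_some,
              Part.mem_some_iff] at hw
            obtain ⟨a, ha, b, hb, rfl⟩ := hw
            rw [Part.get_eq_of_mem ha, Part.get_eq_of_mem hb]
            rfl
          · exact (hd (by simp [Code.cons_eval, Part.bind_dom, hf, hg, Part.pure_eq_some])).elim
        · refine ⟨_, _, ⟨_, rfl, hg'⟩, Or.inr ⟨hf, rfl⟩, ?_⟩
          rcases h with ⟨w, hw, rfl⟩ | ⟨-, rfl⟩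
          · simp only [Code.cons_eval, Part.bind_eq_bind, Part.mem_bind_iff] at hw
            obtain ⟨a, ha, -⟩ := hw
            exact (hf (Part.dom_iff_mem.2 ⟨a, ha⟩)).elim
          · rfl
      · refine ⟨none, none, ⟨_, rfl, none, Or.inr ⟨hg, rfl⟩, rfl⟩, rfl, ?_⟩
        rcases h with ⟨w, hw, rfl⟩ | ⟨-, rfl⟩
        · simp only [Code.cons_eval, Part.bind_eq_bind, Part.mem_bind_iff] at hw
          obtain ⟨a, -, b, hb, -⟩ := hw
          exact (hg (Part.dom_iff_mem.2 ⟨b, hb⟩)).elim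
        · rfl
  | comp f g ihf ihg =>
    simp only [codeRules, List.forall_mem_cons, List.forall_mem_append]
    refine ⟨?_, ihf, ihg⟩
    rintro x y ⟨_, rfl, h⟩
    obtain ⟨z, h₁, h₂⟩ := runRel_bind (g := g.eval) (h := f.eval)
      (by rwa [rel, Code.comp_eval] at h)
    exact ⟨z, ⟨_, rfl, h₁⟩, h₂⟩
  | case f g ihf ihg =>
    simp only [codeRules, List.forall_mem_cons, List.forall_mem_append]
    refine ⟨?_, ?_, ?_, ihf, ihg⟩
    all_goals
      rintro (_ | _ | ⟨_ | ⟨n, v⟩, s⟩) y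
      all_goals simp [compRel, rel, runRel, Part.pure_eq_some, Code.case_eval]
  | fix f ihf =>
    simp only [codeRules, List.forall_mem_cons, List.forall_mem_append]
    refine ⟨?_, ?_, ?_, ?_, tailRules_valid, ihf⟩
    · rintro x y ⟨_, rfl, h⟩
      obtain ⟨z, h₁, h₂⟩ := runRel_bind (g := f.eval) (h := loopFun f)
        (by simpa only [rel, ← fix_eval_eq_bind] using h)
      exact ⟨z, ⟨_, rfl, h₁⟩, h₂⟩
    all_goals
      rintro (_ | _ | ⟨_ | ⟨n, v⟩, s⟩) y
      all_goals simp [compRel, rel, runRel, Part.pure_eq_some, loopFun]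
      all_goals exact Eq.symm

/-- The word of instructions pushing `v`, without the final `nil`. -/
def letters (v : List ℕ) : List Instr :=
  v.flatMap fun n => List.replicate n one ++ [sep]

/-- The word of instructions pushing `v`. -/
def word (v : List ℕ) : List Instr :=
  letters v ++ [nil]

/-- `one` and `sep` are the instructions that build up the top list. -/
def IsLetter (a : Instr) : Prop :=
  a = one ∨ a = sep

theorem isLetter_of_mem_letters {v : List ℕ} {a : Instr} (h : a ∈ letters v) : IsLetter a := by
  simp only [letters, List.mem_flatMap, List.mem_append, List.mem_replicate,
    List.mem_singleton] at h
  obtain ⟨n, -, h | h⟩ := h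
  exacts [Or.inl h.2, Or.inr h]

theorem word_nil (t : List Instr) : word [] ++ t = nil :: t := rfl

theorem word_zero (v : List ℕ) (t : List Instr) : word (0 :: v) ++ t = sep :: (word v ++ t) := by
  simp [word, letters]

theorem word_succ (n : ℕ) (v : List ℕ) (t : List Instr) :
    word ((n + 1) :: v) ++ t = one :: (word (n :: v) ++ t) := by
  simp [word, letters, List.replicate_succ]

section Run

variable {R : List (List Instr × List Instr)}

theorem rewrites_hat_of_isLetter {a : Instr} (hR : hatRules a ⊆ R) (u t : List Instr)
    (hu : ∀ b ∈ u, IsLetter b) : Rewrites R (hat a :: (u ++ nil :: t)) (u ++ nil :: a :: t) := by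
  induction u with
  | nil => exact Rewrites.rule (p := ([hat a, nil], [nil, a])) (hR (by simp [hatRules])) t
  | cons b u ih =>
    have hb : ([hat a, b], [b, hat a]) ∈ R := by
      rcases hu b (by simp) with rfl | rfl <;> exact hR (by simp [hatRules])
    exact (Rewrites.rule hb (u ++ nil :: t)).trans
      ((ih fun c hc => hu c (List.mem_cons_of_mem _ hc)).cons b)

theorem rewrites_hat {a : Instr} (hR : hatRules a ⊆ R) (v : List ℕ) (t : List Instr) :
    Rewrites R (hat a :: (word v ++ t)) (word v ++ a :: t) := by
  simpa [word] using rewrites_hat_of_isLetter hR _ t fun _ => isLetter_of_mem_letters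

theorem rewrites_pop (hR : baseRules ⊆ R) (v : List ℕ) (t : List Instr) :
    Rewrites R (pop :: (word v ++ t)) t := by
  have key (u : List Instr) (hu : ∀ b ∈ u, IsLetter b) :
      Rewrites R (pop :: (u ++ nil :: t)) t := by
    induction u with
    | nil => exact Rewrites.rule (p := ([pop, nil], [])) (hR (by simp [baseRules])) t
    | cons b u ih =>
      have hb : ([pop, b], [pop]) ∈ R := by
        rcases hu b (by simp) with rfl | rfl <;> exact hR (by simp [baseRules])
      exact (Rewrites.rule hb (u ++ nil :: t)).trans
        (ih fun c hc => hu c (List.mem_cons_of_mem _ hc))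
  simpa [word] using key _ fun _ => isLetter_of_mem_letters

theorem rewrites_dup (hR : baseRules ⊆ R) (v : List ℕ) (t : List Instr) :
    Rewrites R (dup :: (word v ++ t)) (word v ++ (word v ++ t)) := by
  have key (u : List Instr) (hu : ∀ b ∈ u, IsLetter b) :
      Rewrites R (dup :: (u ++ nil :: t)) (u ++ nil :: (u ++ nil :: t)) := by
    induction u with
    | nil => exact Rewrites.rule (p := ([dup, nil], [nil, nil])) (hR (by simp [baseRules])) t
    | cons b u ih =>
      have hb : ([dup, b], [b, hat b, dup]) ∈ R := by
        rcases hu b (by simp) with rfl | rfl <;> exact hR (by simp [baseRules])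
      have hh : hatRules b ⊆ R := by
        rcases hu b (by simp) with rfl | rfl <;>
          exact List.Subset.trans (by simp [baseRules]) hR
      have hu' : ∀ c ∈ u, IsLetter c := fun c hc => hu c (List.mem_cons_of_mem _ hc)
      exact ((Rewrites.rule hb (u ++ nil :: t)).trans ((ih hu').append_left [b, hat b])).trans
        ((rewrites_hat_of_isLetter hh u _ hu').cons b)
  simpa [word] using key _ fun _ => isLetter_of_mem_letters

theorem rewrites_head (hR : baseRules ⊆ R) (v w : List ℕ) (t : List Instr) :
    Rewrites R (head :: (word v ++ (word w ++ t))) (word (v.headI :: w) ++ t) := by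
  rcases v with _ | ⟨n, v⟩
  · rw [word_nil, List.headI_nil, Nat.default_eq_zero, word_zero]
    exact Rewrites.rule (p := ([head, nil], [sep])) (hR (by simp [baseRules])) _
  · induction n with
    | zero =>
      rw [word_zero, List.headI_cons, word_zero]
      exact (Rewrites.rule (p := ([head, sep], [sep, pop])) (hR (by simp [baseRules])) _).trans
        ((rewrites_pop hR v _).cons sep)
    | succ n ih =>
      rw [word_succ, List.headI_cons, word_succ]
      exact (Rewrites.rule (p := ([head, one], [one, head])) (hR (by simp [baseRules])) _).trans
        (ih.cons one)

theorem rewrites_tail (hR : tailRules ⊆ R) (v : List ℕ) (t : List Instr) :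
    Rewrites R (run .tail :: (word v ++ t)) (word v.tail ++ t) := by
  rcases v with _ | ⟨n, v⟩
  · exact Rewrites.rule (p := ([run .tail, nil], [nil])) (hR (by simp [tailRules])) t
  · induction n with
    | zero =>
      rw [word_zero]
      exact Rewrites.rule (p := ([run .tail, sep], [])) (hR (by simp [tailRules])) _
    | succ n ih =>
      rw [word_succ]
      exact (Rewrites.rule (p := ([run .tail, one], [run .tail]))
        (hR (by simp [tailRules])) _).trans ih

theorem rewrites_run (hR : baseRules ⊆ R) (c : Code) (hc : codeRules c ⊆ R) {v w : List ℕ}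
    (h : w ∈ c.eval v) (t : List Instr) : Rewrites R (run c :: (word v ++ t)) (word w ++ t) := by
  induction c generalizing v w t with
  | zero' =>
    obtain rfl : w = 0 :: v := by simpa [Part.pure_eq_some] using h
    rw [word_zero]
    exact Rewrites.rule (p := ([run .zero'], [sep])) (hc (by simp [codeRules])) _
  | succ =>
    obtain rfl : w = [v.headI + 1] := by simpa [Part.pure_eq_some] using h
    clear h
    rcases v with _ | ⟨n, v⟩
    · exact Rewrites.rule (p := ([run .succ, nil], [one, sep, nil])) (hc (by simp [codeRules])) t
    · induction n with
      | zero =>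
        rw [word_zero]
        exact (Rewrites.rule (p := ([run .succ, sep], [one, sep, nil, pop]))
          (hc (by simp [codeRules])) _).trans ((rewrites_pop hR v t).append_left [one, sep, nil])
      | succ n ih =>
        rw [word_succ, List.headI_cons, word_succ]
        exact (Rewrites.rule (p := ([run .succ, one], [one, run .succ]))
          (hc (by simp [codeRules])) _).trans (ih.cons one)
  | tail =>
    obtain rfl : w = v.tail := by simpa [Part.pure_eq_some] using h
    exact rewrites_tail hc v t
  | cons f g ihf ihg =>
    simp only [codeRules, List.cons_subset, List.append_subset] at hc
    obtain ⟨hr, ⟨hh, hf⟩, hg⟩ := hc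
    simp only [Code.cons_eval, Part.bind_eq_bind, Part.mem_bind_iff, Part.pure_eq_some,
      Part.mem_some_iff] at h
    obtain ⟨a, ha, b, hb, rfl⟩ := h
    refine (Rewrites.rule hr _).trans ?_
    refine ((rewrites_dup hR v t).append_left [head, run f, hat (run g)]).trans ?_
    refine ((rewrites_hat hh v _).append_left [head, run f]).trans ?_
    refine ((ihf hf ha _).cons head).trans ?_
    exact (((ihg hg hb t).append_left (word a)).cons head).trans (rewrites_head hR a b t)
  | comp f g ihf ihg =>
    simp only [codeRules, List.cons_subset, List.append_subset] at hc
    obtain ⟨hr, hf, hg⟩ := hc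
    rw [Code.comp_eval] at h
    obtain ⟨a, ha, hw⟩ := Part.mem_bind_iff.1 h
    exact (Rewrites.rule hr _).trans (((ihg hg ha t).cons (run f)).trans (ihf hf hw t))
  | case f g ihf ihg =>
    simp only [codeRules, List.cons_subset, List.append_subset] at hc
    obtain ⟨h₁, h₂, h₃, hf, hg⟩ := hc
    rcases v with _ | ⟨_ | n, v⟩
    · exact (Rewrites.rule h₃ t).trans (ihf hf (v := []) (by simpa using h) t)
    · rw [word_zero]
      exact (Rewrites.rule h₂ _).trans (ihf hf (by simpa using h) t)
    · rw [word_succ]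
      exact (Rewrites.rule h₁ _).trans (ihg hg (by simpa using h) t)
  | fix f ihf =>
    simp only [codeRules, List.cons_subset, List.append_subset] at hc
    obtain ⟨hr, h₁, h₂, h₃, ht, hf⟩ := hc
    rw [Code.fix_eval] at h
    refine PFun.fixInduction h (C := fun v => Rewrites R (run f.fix :: (word v ++ t)) (word w ++ t))
      fun v hv ih => ?_
    rw [← Code.fix_eval, fix_eval_eq_bind, Part.mem_bind_iff] at hv
    obtain ⟨u, hu, hw⟩ := hv
    refine (Rewrites.rule hr _).trans (((ihf hf hu t).cons (loop f)).trans ?_)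
    rcases u with _ | ⟨_ | n, u⟩
    · obtain rfl : w = [] := by simpa [loopFun, Part.pure_eq_some] using hw
      exact Rewrites.rule h₃ t
    · obtain rfl : w = u := by simpa [loopFun, Part.pure_eq_some] using hw
      rw [word_zero]
      exact Rewrites.rule h₂ _
    · rw [word_succ]
      refine (Rewrites.rule h₁ _).trans
        (((rewrites_tail ht (n :: u) t).cons (run f.fix)).trans (ih u ?_))
      exact Part.mem_map_iff _ |>.2 ⟨_, hu, by simp⟩

end Run

/-- The word whose derivability as `1` expresses that `c` halts on `v`. -/
def haltWord (c : Code) (v : List ℕ) : List Instr :=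
  pop :: run c :: word v

theorem compRel_word (s : List (List ℕ)) (v : List ℕ) :
    compRel rel (word v) (some s) (some (v :: s)) := by
  induction v with
  | nil => exact ⟨_, rfl, rfl⟩
  | cons n v ih =>
    induction n with
    | zero =>
      have := word_zero v []
      simp only [List.append_nil] at this
      rw [this]
      exact ⟨_, ih, (runRel_pure _ _ _ _).2 rfl⟩
    | succ n ihn =>
      have := word_succ n v []
      simp only [List.append_nil] at this
      rw [this]
      exact ⟨_, ihn, rfl⟩

/-- The antecedent expressing that `c` halts on `v`. -/
def haltSeq (c : Code) (v : List ℕ) : List Fm0 :=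
  (ruleFms num (baseRules ++ codeRules c)).map Fm0.bang ++ wordSeq num (haltWord c v)

theorem dervL_haltSeq_iff (c : Code) (v : List ℕ) :
    DervL true true (haltSeq c v) Fm0.one ↔ (c.eval v).Dom := by
  constructor
  · intro h
    by_contra hd
    have hR : ∀ p ∈ baseRules ++ codeRules c, Valid p :=
      List.forall_mem_append.2 ⟨baseRules_valid, codeRules_valid c⟩
    have := h.word_sound num_injective rel hR (x := some []) (y := none)
      ⟨none, ⟨_, compRel_word [] v, Or.inr ⟨hd, rfl⟩⟩, rfl⟩
    simp at this
  · intro h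
    obtain ⟨w, hw⟩ := Part.dom_iff_mem.1 h
    have hb : baseRules ⊆ baseRules ++ codeRules c := List.subset_append_left _ _
    have h₁ := ((rewrites_run hb c (List.subset_append_right _ _) hw []).cons pop).trans
      (rewrites_pop hb w [])
    rw [List.append_nil] at h₁
    exact h₁.dervL (by simpa [wordSeq] using DervL.bangs_one true _)

end Instr

/-! ## Undecidability -/

theorem encFm0_injective : Function.Injective encFm0 := by
  intro A B h
  induction A generalizing B <;> cases B <;> simp_all [encFm0, Nat.pair_eq_pair] <;> grind

theorem encSeq0_injective {Γ Δ : List Fm0} {A B : Fm0} (h : encSeq0 Γ A = encSeq0 Δ B) :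
    Γ = Δ ∧ A = B := by
  obtain ⟨h₁, h₂⟩ := Nat.pair_eq_pair.1 h
  refine ⟨?_, encFm0_injective h₂⟩
  clear h h₂
  induction Γ generalizing Δ with
  | nil => cases Δ <;> simp_all
  | cons C Γ ih =>
    cases Δ with
    | nil => simp at h₁
    | cons D Δ =>
      simp only [List.map_cons, List.foldr_cons, add_left_inj, Nat.pair_eq_pair] at h₁
      rw [encFm0_injective h₁.1, ih h₁.2]

theorem primrec_foldr_pair (l : List ℕ) {f : ℕ → ℕ} (hf : Primrec f) :
    Primrec fun n => l.foldr (fun a r => Nat.pair a r + 1) (f n) := by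
  induction l with
  | nil => exact hf
  | cons a l ih => exact Primrec.succ.comp (Primrec₂.natPair.comp (Primrec.const a) ih)

theorem foldr_replicate_pair (a b n : ℕ) :
    (List.replicate n a).foldr (fun a r => Nat.pair a r + 1) b =
      (fun r => Nat.pair a r + 1)^[n] b := by
  induction n with
  | zero => rfl
  | succ n ih => rw [List.replicate_succ, List.foldr_cons, ih, Function.iterate_succ_apply']

theorem primrec_encSeq0_haltSeq (c : Turing.ToPartrec.Code) :
    Primrec fun n => encSeq0 (Instr.haltSeq c [n]) Fm0.one := by
  have h (l : List ℕ) (p q r b k : ℕ) : Primrec fun n : ℕ => Nat.pair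
      (l.foldr (fun a r => Nat.pair a r + 1)
        (Nat.pair p (Nat.pair q ((fun r' => Nat.pair r r' + 1)^[n] b) + 1) + 1)) k :=
    Primrec₂.natPair.comp (primrec_foldr_pair l (Primrec.succ.comp (Primrec₂.natPair.comp
      (Primrec.const _) (Primrec.succ.comp (Primrec₂.natPair.comp (Primrec.const _)
      (Primrec.nat_iterate Primrec.id (Primrec.const _)
        (Primrec.succ.comp (Primrec₂.natPair.comp (Primrec.const _) Primrec.snd)).to₂))))))
      (Primrec.const k)
  simp only [encSeq0, Instr.haltSeq, Instr.haltWord, Instr.word, Instr.letters, wordSeq, List.map_append,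
    List.map_cons, List.foldr_append, List.flatMap_cons, List.flatMap_nil, List.append_nil,
    List.map_replicate, List.foldr_cons, foldr_replicate_pair]
  exact h _ _ _ _ _ _

/-- There is a code with an undecidable halting problem. -/
theorem exists_code_not_computable_dom :
    ∃ c : Turing.ToPartrec.Code, ¬ ComputablePred fun n : ℕ => (c.eval [n]).Dom := by
  have hu : Partrec fun n : ℕ => Nat.Partrec.Code.eval (Denumerable.ofNat Nat.Partrec.Code n) 0 :=
    Nat.Partrec.Code.eval_part.comp (Computable.ofNat _) (Computable.const 0)
  obtain ⟨c, hc⟩ := Turing.ToPartrec.Code.exists_code (Nat.Partrec'.part_iff₁.2 hu)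
  refine ⟨c, fun h => ComputablePred.halting_problem 0 ?_⟩
  have h' : ComputablePred fun d : Nat.Partrec.Code => (c.eval [Encodable.encode d]).Dom :=
    ComputablePred.computable_of_manyOneReducible
      ⟨Encodable.encode, Computable.encode, fun _ => Iff.rfl⟩ h
  refine h'.of_eq fun d => ?_
  have := hc ⟨[Encodable.encode d], rfl⟩
  simp only at this
  rw [this]
  simp [List.Vector.head]

/-- The derivability problem for `!wL1` is undecidable:
the set of codes of derivable sequents (under the effective injective coding
`encSeq0`) is not computable. -/
theorem wL_undecidable :
    ¬ ComputablePred (fun n : ℕ =>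
      ∃ Γ : List Fm0, ∃ A : Fm0, encSeq0 Γ A = n ∧ DervL true true Γ A) := by
  intro h
  obtain ⟨c, hc⟩ := exists_code_not_computable_dom
  refine hc (ComputablePred.computable_of_manyOneReducible
    ⟨fun n => encSeq0 (Instr.haltSeq c [n]) Fm0.one, (primrec_encSeq0_haltSeq c).to_comp,
      fun n => ?_⟩ h)
  refine (Instr.dervL_haltSeq_iff c [n]).symm.trans ⟨fun hd => ⟨_, Fm0.one, rfl, hd⟩, ?_⟩
  rintro ⟨Γ, A, hΓ, hd⟩
  obtain ⟨rfl, rfl⟩ := encSeq0_injective hΓ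
  exact hd

end Lambek
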